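/- arXiv:2001.09510 — 5 statements merged into one kernel-verified Lean document; each statement's English description precedes it below -/
import Mathlib

section
/- Let T = (V, E) be a finite tree with at least two vertices and let U ⊆ V. If some vertex v ∈ V \ U has degree one in T, then the map sending w ∈ (0,∞)^E to the collection of path sums (p_w(a,b))_{a,b ∈ U} is not injective. -/
open SimpleGraph Finset

variable {V : Type*}

/-- The unique path between two vertices of a tree, as a walk. -/
noncomputable def treePath (G : SimpleGraph V) (hG : G.IsTree) (a b : V) : G.Walk a b :=
  (hG.existsUnique_path a b).choose

/-- The set of edges of the unique path from `a` to `b` in the tree `G`. -/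
noncomputable def pathEdges [DecidableEq V] (G : SimpleGraph V) (hG : G.IsTree) (a b : V) :
    Finset (Sym2 V) :=
  (treePath G hG a b).edges.toFinset

/-- The path sum `p_w(a,b) = Σ_{e ∈ path(a,b)} w(e)`. -/
noncomputable def pathSum [DecidableEq V] (G : SimpleGraph V) (hG : G.IsTree)
    (w : Sym2 V → ℝ) (a b : V) : ℝ :=
  ∑ e ∈ pathEdges G hG a b, w e

theorem treePath_isPath (G : SimpleGraph V) (hG : G.IsTree) (a b : V) :
    (treePath G hG a b).IsPath :=
  (hG.existsUnique_path a b).choose_spec.1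

/-- An edge at a leaf lies on no path whose two ends both differ from that leaf. -/
theorem notMem_pathEdges_of_subsingleton_neighborSet [DecidableEq V] (G : SimpleGraph V)
    (hG : G.IsTree) {v a b : V} (hv : (G.neighborSet v).Subsingleton) (ha : v ≠ a) (hb : v ≠ b)
    (u : V) : s(v, u) ∉ pathEdges G hG a b := by
  rw [pathEdges, List.mem_toFinset]
  intro h
  exact (treePath_isPath G hG a b).isTrail.not_mem_support_of_subsingleton_neighborSet ha hb hv
    ((treePath G hG a b).fst_mem_support_of_mem_edges h)

/-- In a tree with at least two vertices, if some vertex outside `U` has degree one, then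
the map sending a positive edge-weight vector to the path sums between nodes of `U` is
not injective. -/
theorem path_sums_not_injective_of_latent_leaf
    [Fintype V] [DecidableEq V] (G : SimpleGraph V) [DecidableRel G.Adj]
    (hG : G.IsTree) (U : Set V) (hcard : 1 < Fintype.card V)
    (v : V) (hv : v ∉ U) (hdeg : G.degree v = 1) :
    ¬ (∀ w w' : Sym2 V → ℝ,
        (∀ e ∈ G.edgeSet, 0 < w e) → (∀ e ∈ G.edgeSet, 0 < w' e) →
        (∀ a ∈ U, ∀ b ∈ U, pathSum G hG w a b = pathSum G hG w' a b) →
        ∀ e ∈ G.edgeSet, w e = w' e) := by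
  obtain ⟨u, hu, huniq⟩ := degree_eq_one_iff_existsUnique_adj.mp hdeg
  have hsub : (G.neighborSet v).Subsingleton := fun x hx y hy =>
    (huniq x hx).trans (huniq y hy).symm
  intro hinj
  have h := hinj (fun _ => 1) (Function.update (fun _ => 1) s(v, u) 2)
    (fun _ _ => one_pos)
    (fun e _ => by
      by_cases he : e = s(v, u)
      · subst he
        simp
      · simp [Function.update_of_ne he])
    (fun a ha b hb => by
      refine Finset.sum_congr rfl fun e he => ?_
      have hne : e ≠ s(v, u) := by
        rintro rfl
        exact notMem_pathEdges_of_subsingleton_neighborSet G hG hsub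
          (fun h => hv (h ▸ ha)) (fun h => hv (h ▸ hb)) u he
      rw [Function.update_of_ne hne])
    s(v, u) hu
  norm_num at h
end

section
/- Let T = (V, E) be a finite tree and let U ⊆ V. If some vertex v ∈ V \ U has degree two in T, then the map sending w ∈ (0,∞)^E to the collection of path sums (p_w(a,b))_{a,b ∈ U} is not injective. -/
open SimpleGraph Finset

variable {V : Type*}

/-- A path that passes through a vertex `v` of degree two, other than its endpoints, and uses one of
the two edges at `v` uses the other one as well. -/
theorem SimpleGraph.Walk.IsPath.mk_mem_edges_of_neighborFinset_eq_pair
    [DecidableEq V] {G : SimpleGraph V} {a b v x y : V} [Fintype (G.neighborSet v)]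
    {p : G.Walk a b} (hp : p.IsPath) (ha : a ≠ v) (hb : b ≠ v)
    (hN : G.neighborFinset v = {x, y}) (hx : s(v, x) ∈ p.edges) : s(v, y) ∈ p.edges := by
  obtain ⟨i, hi, hil⟩ := Walk.mem_support_iff_exists_getVert.mp (p.fst_mem_support_of_mem_edges hx)
  have hi0 : i ≠ 0 := by
    rintro rfl
    exact ha (by simpa using hi)
  have hlt : i < p.length := by
    refine lt_of_le_of_ne hil ?_
    rintro rfl
    exact hb (by simpa using hi)
  have hcard := hp.ncard_neighborSet_toSubgraph_internal_eq_two hi0 hlt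
  rw [hi] at hcard
  have hsub : p.toSubgraph.neighborSet v ⊆ {x, y} := by
    intro z hz
    have hz' : z ∈ G.neighborFinset v := by
      simpa using p.toSubgraph.adj_sub hz
    simpa [hN] using hz'
  have heq : p.toSubgraph.neighborSet v = {x, y} :=
    Set.eq_of_subset_of_ncard_le hsub
      (by simpa [hcard] using Set.ncard_insert_le x {y}) (Set.toFinite _)
  have hy : y ∈ p.toSubgraph.neighborSet v := by simp [heq]
  exact (p.mem_edges_toSubgraph).mp hy

/-- If some vertex outside `U` has degree two in the tree, then the map sending a positive
edge-weight vector to the path sums between nodes of `U` is not injective. -/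
theorem path_sums_not_injective_of_latent_degree_two
    [Fintype V] [DecidableEq V] (G : SimpleGraph V) [DecidableRel G.Adj]
    (hG : G.IsTree) (U : Set V)
    (v : V) (hv : v ∉ U) (hdeg : G.degree v = 2) :
    ¬ (∀ w w' : Sym2 V → ℝ,
        (∀ e ∈ G.edgeSet, 0 < w e) → (∀ e ∈ G.edgeSet, 0 < w' e) →
        (∀ a ∈ U, ∀ b ∈ U, pathSum G hG w a b = pathSum G hG w' a b) →
        ∀ e ∈ G.edgeSet, w e = w' e) := by
  intro h
  obtain ⟨x, y, hxy, hN⟩ := Finset.card_eq_two.mp ((G.card_neighborFinset_eq_degree v).trans hdeg)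
  have hadj : G.Adj v x := by
    rw [← mem_neighborFinset, hN]
    simp
  have hne : s(v, x) ≠ s(v, y) := fun he ↦ hxy (Sym2.congr_right.mp he)
  let d : Sym2 V → ℝ := fun e ↦
    (if s(v, x) = e then 1 / 2 else 0) - (if s(v, y) = e then 1 / 2 else 0)
  have hd : ∀ e, 0 < 1 + d e := by
    intro e
    simp only [d]
    split_ifs <;> norm_num
  have hsum : ∀ a ∈ U, ∀ b ∈ U,
      pathSum G hG (fun _ ↦ 1) a b = pathSum G hG (fun e ↦ 1 + d e) a b := by
    intro a ha b hb
    have hav : a ≠ v := fun hv' ↦ hv (hv' ▸ ha)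
    have hbv : b ≠ v := fun hv' ↦ hv (hv' ▸ hb)
    have hp : (treePath G hG a b).IsPath := (hG.existsUnique_path a b).choose_spec.1
    have hiff : s(v, x) ∈ pathEdges G hG a b ↔ s(v, y) ∈ pathEdges G hG a b := by
      simp only [pathEdges, List.mem_toFinset]
      exact ⟨hp.mk_mem_edges_of_neighborFinset_eq_pair hav hbv hN,
        hp.mk_mem_edges_of_neighborFinset_eq_pair hav hbv (hN.trans (Finset.pair_comm x y))⟩
    simp [pathSum, d, Finset.sum_add_distrib, Finset.sum_sub_distrib, hiff]
  have hcontra := h _ _ (fun _ _ ↦ one_pos) (fun e _ ↦ hd e) hsum s(v, x) hadj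
  simp [d, hne.symm] at hcontra
end

section
/- Let T = (V, E) be a finite tree and let U ⊆ V be such that every vertex of V \ U has degree at least three in T. Then for every edge e ∈ E there exist rational coefficients c : U × U → ℚ (not depending on the weights) such that for every edge-weight vector w : E → ℝ one has w(e) = Σ_{(a,b) ∈ U × U} c(a,b) · p_w(a,b); moreover the coefficients can be chosen so that at most six of them are nonzero and each nonzero coefficient lies in {±1/2, ±1}. -/
open SimpleGraph Finset

variable {V : Type*}

theorem pathSum_eq_sum_edges [DecidableEq V] {G : SimpleGraph V} (hG : G.IsTree)
    (w : Sym2 V → ℝ) {a b : V} {p : G.Walk a b} (hp : p.IsPath) :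
    pathSum G hG w a b = (p.edges.map w).sum := by
  have h : treePath G hG a b = p :=
    (hG.existsUnique_path a b).unique (hG.existsUnique_path a b).choose_spec.1 hp
  rw [pathSum, pathEdges, h, List.sum_toFinset _ hp.isTrail.edges_nodup]

/-- In an acyclic graph, a path can be extended at a start of degree at least two. -/
theorem exists_isPath_cons [Fintype V] [DecidableEq V] {G : SimpleGraph V} [DecidableRel G.Adj]
    (hG : G.IsAcyclic) {u v : V} {p : G.Walk u v} (hp : p.IsPath) (hu : 2 ≤ G.degree u) :
    ∃ (z : V) (h : G.Adj z u), (Walk.cons h p).IsPath := by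
  obtain ⟨z, hz, hne⟩ := Finset.exists_mem_ne (s := G.neighborFinset u) (by
    rw [card_neighborFinset_eq_degree]; omega) p.snd
  rw [mem_neighborFinset] at hz
  refine ⟨z, hz.symm, ?_⟩
  rw [Walk.cons_isPath_iff]
  exact ⟨hp, fun hs => hne (hG.eq_snd_of_adj_start hp hz hs)⟩

/-- If all vertices outside `U` have degree at least two, then in an acyclic graph every edge
`xy` is the end of a path that starts in `U`. -/
theorem exists_isPath_concat [Fintype V] [DecidableEq V] {G : SimpleGraph V} [DecidableRel G.Adj]
    (hG : G.IsAcyclic) {U : Finset V} (hU : ∀ v, v ∉ U → 2 ≤ G.degree v) {x y : V}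
    (hxy : G.Adj x y) :
    ∃ a ∈ U, ∃ q : G.Walk a x, (q.concat hxy).IsPath := by
  by_contra! hcon
  have key : ∀ n : ℕ, ∃ (a : V) (q : G.Walk a x), (q.concat hxy).IsPath ∧ q.length = n := by
    intro n
    induction n with
    | zero => exact ⟨x, .nil, by simp [Walk.concat_eq_append, hxy.ne], rfl⟩
    | succ n ih =>
      obtain ⟨a, q, hq, hl⟩ := ih
      have ha : a ∉ U := fun ha => hcon a ha q hq
      obtain ⟨z, hz, hp⟩ := exists_isPath_cons hG hq (hU a ha)
      exact ⟨z, .cons hz q, hp, by simp [hl]⟩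
  obtain ⟨a, q, hq, hl⟩ := key (Fintype.card V)
  have := hq.length_lt
  rw [Walk.length_concat] at this
  omega

/-- In an acyclic graph, two paths that traverse the same edge last, in opposite directions,
glue to a path. -/
theorem isPath_concat_append_reverse {G : SimpleGraph V} (hG : G.IsAcyclic) {a b x y : V}
    (hxy : G.Adj x y) {q : G.Walk a x} {r : G.Walk b y} (hq : (q.concat hxy).IsPath)
    (hr : (r.concat hxy.symm).IsPath) : ((q.concat hxy).append r.reverse).IsPath := by
  replace hr := hr.reverse
  rw [hG.isPath_iff_isChain] at *
  simp only [Walk.edges_append, Walk.edges_concat, Walk.edges_reverse, List.concat_eq_append,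
    List.reverse_append, List.reverse_singleton] at *
  rw [Sym2.eq_swap] at hr
  exact hq.append_overlap hr (by simp)

/-- In an acyclic graph, two paths that end at the same vertex with distinct last edges
glue to a path. -/
theorem isPath_concat_append_reverse_concat {G : SimpleGraph V} (hG : G.IsAcyclic)
    {a b x y z : V} (hxz : G.Adj x z) (hyz : G.Adj y z) (hne : x ≠ y) {q : G.Walk a x}
    {r : G.Walk b y} (hq : (q.concat hxz).IsPath) (hr : (r.concat hyz).IsPath) :
    ((q.concat hxz).append (r.concat hyz).reverse).IsPath := by
  replace hr := hr.reverse
  rw [hG.isPath_iff_isChain] at *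
  rw [Walk.edges_append]
  refine hq.append hr ?_
  simp only [Walk.edges_concat, Walk.edges_reverse, List.concat_eq_append]
  simpa [hne] using fun h : x = z => absurd h hxz.ne

/-- The side of `x` of an edge `xy` contains two vertices of `U` (both equal to `x` if `x ∈ U`)
whose connecting path passes through `x`. -/
theorem exists_pair_isPath_concat [Fintype V] [DecidableEq V] {G : SimpleGraph V}
    [DecidableRel G.Adj] (hG : G.IsAcyclic) {U : Finset V} (hU : ∀ v, v ∉ U → 3 ≤ G.degree v)
    {x y : V} (hxy : G.Adj x y) :
    ∃ a₁ ∈ U, ∃ a₂ ∈ U, ∃ (q₁ : G.Walk a₁ x) (q₂ : G.Walk a₂ x), (q₁.concat hxy).IsPath ∧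
      (q₂.concat hxy).IsPath ∧ (q₁.append q₂.reverse).IsPath := by
  by_cases hx : x ∈ U
  · exact ⟨x, hx, x, hx, .nil, .nil, by simp [Walk.concat_eq_append, hxy.ne],
      by simp [Walk.concat_eq_append, hxy.ne], by simp⟩
  have hcard : 1 < ((G.neighborFinset x).erase y).card := by
    rw [Finset.card_erase_of_mem (by simpa using hxy), card_neighborFinset_eq_degree]
    have := hU x hx
    omega
  obtain ⟨x₁, h₁, x₂, h₂, hne⟩ := Finset.one_lt_card.1 hcard
  simp only [Finset.mem_erase, mem_neighborFinset] at h₁ h₂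
  have hU' : ∀ v, v ∉ U → 2 ≤ G.degree v := fun v hv => (hU v hv).trans' (by norm_num)
  have extend : ∀ {b z : V} (h : G.Adj z x) (q : G.Walk b z), z ≠ y → (q.concat h).IsPath →
      ((q.concat h).concat hxy).IsPath := by
    intro b z h q hz hq
    rw [Walk.concat_eq_append (q.concat h)]
    refine (isPath_concat_append_reverse_concat hG h hxy.symm hz hq (r := .nil) ?_)
    simp [Walk.concat_eq_append, hxy.ne']
  obtain ⟨a₁, ha₁, q₁, hq₁⟩ := exists_isPath_concat hG hU' h₁.2.symm
  obtain ⟨a₂, ha₂, q₂, hq₂⟩ := exists_isPath_concat hG hU' h₂.2.symm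
  exact ⟨a₁, ha₁, a₂, ha₂, _, _, extend _ _ h₁.1 hq₁, extend _ _ h₂.1 hq₂,
    isPath_concat_append_reverse_concat hG _ _ hne hq₁ hq₂⟩

/-- If every vertex outside `U` has degree at least three, then every edge weight `w(e)`
can be recovered as a fixed rational linear combination of the path sums between nodes of
`U`, with at most six nonzero coefficients, each in `{±1/2, ±1}`. -/
theorem edge_weight_eq_linear_combination_of_path_sums
    [Fintype V] [DecidableEq V] (G : SimpleGraph V) [DecidableRel G.Adj]
    (hG : G.IsTree) (U : Finset V) (hU : ∀ v : V, v ∉ U → 3 ≤ G.degree v) :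
    ∀ e ∈ G.edgeSet, ∃ c : V × V → ℚ,
      (∀ p : V × V, c p ≠ 0 → p.1 ∈ U ∧ p.2 ∈ U) ∧
      (Finset.univ.filter fun p : V × V => c p ≠ 0).card ≤ 6 ∧
      (∀ p : V × V, c p ≠ 0 →
        c p = 1 / 2 ∨ c p = -(1 / 2) ∨ c p = 1 ∨ c p = -1) ∧
      (∀ w : Sym2 V → ℝ,
        w e = ∑ p ∈ U ×ˢ U, (c p : ℝ) * pathSum G hG w p.1 p.2) := by
  intro e he
  induction e using Sym2.ind with | _ x y =>
  have hxy : G.Adj x y := he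
  have hA := hG.isAcyclic
  obtain ⟨a₁, ha₁, a₂, ha₂, q₁, q₂, hq₁, hq₂, hq⟩ := exists_pair_isPath_concat hA hU hxy
  obtain ⟨b₁, hb₁, b₂, hb₂, r₁, r₂, hr₁, hr₂, hr⟩ := exists_pair_isPath_concat hA hU hxy.symm
  have ne : ∀ {a b : V} {q : G.Walk a x} {r : G.Walk b y}, (q.concat hxy).IsPath →
      (r.concat hxy.symm).IsPath → a ≠ b := by
    rintro a b q r hq hr rfl
    have h := Walk.isPath_iff_nil.1 (isPath_concat_append_reverse hA hxy hq hr)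
    simpa using Walk.length_eq_zero_iff.2 h
  have n₁₁ := ne hq₁ hr₁
  have n₁₂ := ne hq₁ hr₂
  have n₂₁ := ne hq₂ hr₁
  have n₂₂ := ne hq₂ hr₂
  let c : V × V → ℚ := fun p =>
    (if p = (a₁, b₁) then 1 / 2 else 0) + (if p = (a₂, b₂) then 1 / 2 else 0)
      - (if p = (a₁, a₂) then 1 / 2 else 0) - (if p = (b₁, b₂) then 1 / 2 else 0)
  have hsupp : ∀ p, c p ≠ 0 → p ∈ ({(a₁, b₁), (a₂, b₂), (a₁, a₂), (b₁, b₂)} : Finset (V × V)) := by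
    intro p hp
    contrapose! hp
    simp only [Finset.mem_insert, Finset.mem_singleton, not_or] at hp
    simp [c, hp]
  refine ⟨c, fun p hp => ?_, ?_, fun p hp => ?_, fun w => ?_⟩
  · have := hsupp p hp
    simp only [Finset.mem_insert, Finset.mem_singleton] at this
    rcases this with rfl | rfl | rfl | rfl <;> simp [*]
  · refine (Finset.card_le_card fun p hp => hsupp p (Finset.mem_filter.1 hp).2).trans ?_
    exact Finset.card_le_four.trans (by norm_num)
  · have := hsupp p hp
    simp only [Finset.mem_insert, Finset.mem_singleton] at this
    rcases this with rfl | rfl | rfl | rfl <;> simp only [c, Prod.mk.injEq] <;> grind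
  · have hsum : ∑ p ∈ U ×ˢ U, (c p : ℝ) * pathSum G hG w p.1 p.2 =
        (pathSum G hG w a₁ b₁ + pathSum G hG w a₂ b₂ - pathSum G hG w a₁ a₂
          - pathSum G hG w b₁ b₂) / 2 := by
      have single : ∀ a ∈ U, ∀ b ∈ U, ∑ p ∈ U ×ˢ U,
          ((if p = (a, b) then 1 / 2 else 0 : ℚ) : ℝ) * pathSum G hG w p.1 p.2
            = pathSum G hG w a b / 2 := by
        intro a ha b hb
        simp only [apply_ite (Rat.cast : ℚ → ℝ), Rat.cast_zero, ite_mul, zero_mul]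
        rw [Finset.sum_ite_eq' _ (a, b), if_pos (Finset.mk_mem_product ha hb)]
        push_cast
        ring
      simp only [c, Rat.cast_add, Rat.cast_sub, add_mul, sub_mul, Finset.sum_add_distrib, Finset.sum_sub_distrib]
      rw [single _ ha₁ _ hb₁, single _ ha₂ _ hb₂, single _ ha₁ _ ha₂, single _ hb₁ _ hb₂]
      ring
    rw [hsum, pathSum_eq_sum_edges hG w (isPath_concat_append_reverse hA hxy hq₁ hr₁),
      pathSum_eq_sum_edges hG w (isPath_concat_append_reverse hA hxy hq₂ hr₂),
      pathSum_eq_sum_edges hG w hq, pathSum_eq_sum_edges hG w hr]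
    simp only [Walk.edges_append, Walk.edges_concat, Walk.edges_reverse, List.concat_eq_append,
      List.map_append, List.sum_append, List.map_reverse, List.sum_reverse, List.map_cons,
      List.map_nil, List.sum_cons, List.sum_nil]
    ring
end

section
/- Let T = (V, E) be a finite tree, let u ∈ V, and let w : E → ℝ satisfy w(e) > 0 for every e ∈ E. Define the symmetric matrix M indexed by V \ {u} with entries M(i,j) = Σ_{e ∈ path(u,i) ∩ path(u,j)} w(e). Then M is positive definite: for every nonzero vector x ∈ ℝ^{V \ {u}} one has xᵀ M x > 0. -/
open SimpleGraph Finset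

variable {V : Type*}

theorem mem_edgeSet_of_mem_pathEdges [DecidableEq V] {G : SimpleGraph V} {hG : G.IsTree}
    {a b : V} {e : Sym2 V} (he : e ∈ pathEdges G hG a b) : e ∈ G.edgeSet :=
  (treePath G hG a b).edges_subset_edgeSet (List.mem_toFinset.1 he)

/-- The last edge of a nontrivial path in a tree lies only on those other paths from the same
root which are strictly longer. -/
theorem exists_mem_pathEdges_forall_length_lt [DecidableEq V] (G : SimpleGraph V)
    (hG : G.IsTree) {u i : V} (hi : i ≠ u) :
    ∃ e ∈ pathEdges G hG u i, ∀ j, j ≠ i → e ∈ pathEdges G hG u j →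
      (treePath G hG u i).length < (treePath G hG u j).length := by
  refine ⟨s((treePath G hG u i).penultimate, i), List.mem_toFinset.2 <|
    Walk.mk_penultimate_end_mem_edges (Walk.not_nil_of_ne hi.symm), fun j hj he => ?_⟩
  have hmem : i ∈ (treePath G hG u j).support :=
    Walk.snd_mem_support_of_mem_edges _ (List.mem_toFinset.1 he)
  have heq : (treePath G hG u j).takeUntil i hmem = treePath G hG u i :=
    (hG.existsUnique_path u i).unique ((treePath_isPath G hG u j).takeUntil hmem)
      (treePath_isPath G hG u i)
  rw [← heq]
  exact Walk.length_takeUntil_lt_length hmem hj.symm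

/-- A quadratic form whose coefficients are weights of intersections is a weighted sum of
squares. -/
theorem sum_mul_sum_inter_eq_sum_mul_sq {ι E : Type*} [Fintype ι] [Fintype E] [DecidableEq E]
    (P : ι → Finset E) (w : E → ℝ) (x : ι → ℝ) :
    ∑ i, x i * ∑ j, (∑ e ∈ P i ∩ P j, w e) * x j =
      ∑ e, w e * (∑ i, if e ∈ P i then x i else 0) ^ 2 := by
  have hinter (i j : ι) : ∑ e ∈ P i ∩ P j, w e =
      ∑ e, if e ∈ P i then (if e ∈ P j then w e else 0) else 0 := by
    simp [← ite_and, ← Finset.mem_inter, Finset.sum_ite_mem]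
  simp_rw [hinter, sq, Finset.sum_mul_sum, Finset.mul_sum, Finset.sum_mul, Finset.mul_sum]
  symm
  rw [Finset.sum_comm]
  refine Finset.sum_congr rfl fun i _ => ?_
  rw [Finset.sum_comm]
  refine Finset.sum_congr rfl fun j _ => Finset.sum_congr rfl fun e _ => ?_
  split_ifs <;> ring

/-- For positive edge weights, the matrix indexed by the vertices other than `u` whose
`(i,j)` entry is the sum of the weights over the edges common to the paths from `u` to
`i` and from `u` to `j` is positive definite. -/
theorem commonPathWeight_matrix_posDef
    [Fintype V] [DecidableEq V] (G : SimpleGraph V)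
    (hG : G.IsTree) (u : V) (w : Sym2 V → ℝ) (hw : ∀ e ∈ G.edgeSet, 0 < w e) :
    Matrix.PosDef (Matrix.of fun i j : {v : V // v ≠ u} =>
      ∑ e ∈ pathEdges G hG u ↑i ∩ pathEdges G hG u ↑j, w e) := by
  refine Matrix.PosDef.of_dotProduct_mulVec_pos ?_ fun x hx => ?_
  · ext i j
    simp [Finset.inter_comm]
  · have hform := sum_mul_sum_inter_eq_sum_mul_sq
      (fun i : {v : V // v ≠ u} => pathEdges G hG u ↑i) w x
    simp only [dotProduct, Matrix.mulVec, Matrix.of_apply, star_trivial]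
    rw [hform]
    obtain ⟨k, hk⟩ := Function.ne_iff.1 hx
    obtain ⟨i, hi, hmax⟩ := (univ.filter fun i => x i ≠ 0).exists_max_image
      (fun i => (treePath G hG u ↑i).length) ⟨k, by simpa using hk⟩
    have hxi : x i ≠ 0 := (mem_filter.1 hi).2
    obtain ⟨e, he, hlt⟩ := exists_mem_pathEdges_forall_length_lt G hG i.2
    refine Finset.sum_pos' (fun f _ => ?_) ⟨e, mem_univ e, ?_⟩
    · by_cases hf : f ∈ G.edgeSet
      · exact mul_nonneg (hw f hf).le (sq_nonneg _)
      · have hzero (j : {v : V // v ≠ u}) : f ∉ pathEdges G hG u ↑j :=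
          fun h => hf (mem_edgeSet_of_mem_pathEdges h)
        simp [hzero]
    · refine mul_pos (hw e (mem_edgeSet_of_mem_pathEdges he)) ?_
      rw [Finset.sum_eq_single_of_mem i (mem_univ i), if_pos he]
      · positivity
      · intro j _ hj
        refine ite_eq_right_iff.2 fun hej => ?_
        by_contra hxj
        exact (hlt j (Subtype.coe_injective.ne hj) hej).not_ge (hmax j (by simpa using hxj))
end

section
/- Let T = (V, E) be a finite tree and let u ∈ V. Define the matrix A ∈ ℝ^{(V \ {u}) × E} by A(v,e) = 1 if e ∈ path(u,v) and A(v,e) = 0 otherwise. Since |V \ {u}| = |E| for a tree, A is a square matrix, and A is invertible. -/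
open SimpleGraph Finset

variable {V : Type*}

/-- The path sum changes by the weight of the last edge when a path is extended by one edge. -/
theorem pathSum_eq_add_of_mem_support [DecidableEq V] (G : SimpleGraph V) (hG : G.IsTree)
    (w : Sym2 V → ℝ) {u a b : V} (hadj : G.Adj a b) (ha : a ∈ (treePath G hG u b).support) :
    pathSum G hG w u b = pathSum G hG w u a + w s(a, b) := by
  have hq := treePath_isPath G hG u b
  have heq := hG.isAcyclic.path_concat (treePath_isPath G hG u a) hq hadj ha
  have hnd := hq.isTrail.edges_nodup
  rw [heq, Walk.edges_concat, List.concat_eq_append] at hnd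
  have hnot : s(a, b) ∉ (treePath G hG u a).edges := fun h =>
    (List.nodup_append.mp hnd).2.2 _ h _ (List.mem_singleton_self _) rfl
  have hedges : pathEdges G hG u b = insert s(a, b) (pathEdges G hG u a) := by
    ext e
    simp [pathEdges, heq, Walk.edges_concat]
  rw [pathSum, hedges, Finset.sum_insert (by simpa [pathEdges] using hnot), add_comm, pathSum]

/-- A weight whose path sums from a fixed root all vanish is zero on every edge. -/
theorem eq_zero_of_pathSum_eq_zero [DecidableEq V] (G : SimpleGraph V) (hG : G.IsTree)
    (w : Sym2 V → ℝ) (u : V) (h : ∀ v, pathSum G hG w u v = 0) {e : Sym2 V}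
    (he : e ∈ G.edgeSet) : w e = 0 := by
  induction e with | _ a b
  rw [mem_edgeSet] at he
  by_cases ha : a ∈ (treePath G hG u b).support
  · simpa [h] using (pathSum_eq_add_of_mem_support G hG w he ha).symm
  · have hb := hG.isAcyclic.mem_support_of_ne_mem_support_of_adj_of_isPath
      (treePath_isPath G hG u a) (treePath_isPath G hG u b) he ha
    simpa [h, Sym2.eq_swap] using (pathSum_eq_add_of_mem_support G hG w he.symm hb).symm

theorem pathSum_self [DecidableEq V] (G : SimpleGraph V) (hG : G.IsTree)
    (w : Sym2 V → ℝ) (u : V) : pathSum G hG w u u = 0 := by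
  have h : treePath G hG u u = Walk.nil :=
    (hG.existsUnique_path u u).unique (treePath_isPath G hG u u) Walk.IsPath.nil
  simp [pathSum, pathEdges, h]

theorem pathSum_eq_sum_edgeSet [DecidableEq V] (G : SimpleGraph V) [Fintype G.edgeSet]
    (hG : G.IsTree) (w : Sym2 V → ℝ) (a b : V) :
    pathSum G hG w a b =
      ∑ e : G.edgeSet, (if (e : Sym2 V) ∈ pathEdges G hG a b then (1 : ℝ) else 0) * w e := by
  have hsub : pathEdges G hG a b ⊆ G.edgeFinset := fun e he =>
    mem_edgeFinset.mpr (Walk.edges_subset_edgeSet _ (List.mem_toFinset.mp he))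
  rw [← Finset.sum_subtype G.edgeFinset (fun _ => mem_edgeFinset)
    (fun e => (if e ∈ pathEdges G hG a b then (1 : ℝ) else 0) * w e)]
  simp only [ite_mul, one_mul, zero_mul]
  rw [Finset.sum_ite_mem, Finset.inter_eq_right.mpr hsub, pathSum]

/-- In a tree, fix a root `u`. The 0/1 matrix `A` indexed by `(V \ {u}) × E` with
`A(v,e) = 1` iff `e` lies on the path from `u` to `v` is square (since
`|V \ {u}| = |E|`) and invertible (its associated linear map is bijective). -/
theorem path_incidence_matrix_invertible
    [Fintype V] [DecidableEq V] (G : SimpleGraph V) [DecidableRel G.Adj]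
    (hG : G.IsTree) (u : V) :
    Fintype.card {v : V // v ≠ u} = Fintype.card G.edgeSet ∧
    Function.Bijective
      (Matrix.mulVecLin (R := ℝ)
        (Matrix.of fun (v : {v : V // v ≠ u}) (e : G.edgeSet) =>
          if (e : Sym2 V) ∈ pathEdges G hG u ↑v then (1 : ℝ) else 0)) := by
  have hcard : Fintype.card {v : V // v ≠ u} = Fintype.card G.edgeSet := by
    have h := hG.card_edgeFinset
    rw [edgeFinset_card] at h
    rw [Fintype.card_subtype_compl, Fintype.card_subtype_eq]
    omega
  have hinj : Function.Injective
      (Matrix.mulVecLin (R := ℝ)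
        (Matrix.of fun (v : {v : V // v ≠ u}) (e : G.edgeSet) =>
          if (e : Sym2 V) ∈ pathEdges G hG u ↑v then (1 : ℝ) else 0)) := by
    refine (injective_iff_map_eq_zero _).mpr fun x hx => ?_
    let w : Sym2 V → ℝ := fun e => if h : e ∈ G.edgeSet then x ⟨e, h⟩ else 0
    have hw : ∀ e : G.edgeSet, w e = x e := fun e => dif_pos e.2
    have hsum : ∀ v, pathSum G hG w u v = 0 := by
      intro v
      by_cases hv : v = u
      · rw [hv, pathSum_self]
      · rw [pathSum_eq_sum_edgeSet]
        simp only [hw]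
        exact congrFun hx ⟨v, hv⟩
    funext e
    rw [← hw e]
    exact eq_zero_of_pathSum_eq_zero G hG w u hsum e.2
  refine ⟨hcard, hinj, (LinearMap.injective_iff_surjective_of_finrank_eq_finrank ?_).mp hinj⟩
  simp only [Module.finrank_fintype_fun_eq_card, hcard]
end
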